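/- arXiv:1102.2957 — 2 statements merged into one kernel-verified Lean document; each statement's English description precedes it below -/
import Mathlib

section
/- Let R be a commutative ring, W ∈ R, and (X,d) a linear factorisation of W over R. Let t₁,…,tₙ ∈ R and for each i let λᵢ be an odd R-linear map on X with λᵢ∘d + d∘λᵢ = tᵢ·1_X. Write dtᵢ for the map of left exterior multiplication by dtᵢ on X ⊗_R K(t) (with the Koszul sign: x⊗ω ↦ (−1)^{|x|} x⊗(dtᵢ∧ω)) and λᵢ for λᵢ⊗1. Then θ' = (dt₁ − λ₁)∘⋯∘(dtₙ − λₙ) is a morphism of linear factorisations X[n] → X ⊗_R K(t), and ε∘θ' = 1, where ε: X⊗K(t) → X[n] is the projection ε(x·dt₁⋯dtₙ) = (−1)^{n|x|} x onto the component X·dt₁⋯dtₙ. -/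
/-!
STATEMENT 0.

Conventions.  A ℤ/2-graded `R`-module is encoded as a module `X` with a grading
involution `g` (`g x = (-1)^{|x|} x`); odd maps anticommute with `g`, even maps commute
with it.  A linear factorisation of `W` is an odd `d` with `d ∘ d = W • 1`.

The Koszul complex `K(t)` on `t = (t₁,…,tₙ)` is the exterior algebra on `dt₁,…,dtₙ`
(in degree `-1`) with differential the contraction `δ` with `Σᵢ tᵢ (dtᵢ)*`.  We model
`X ⊗_R K(t)` as `Finset (Fin n) → X`, the component at `I` being `X · dt_I`
(`dt_I = dt_{i₁} ∧ ⋯ ∧ dt_{i_k}` with `i₁ < ⋯ < i_k` the elements of `I`).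
The Koszul sign rule `(f ⊗ g)(x ⊗ y) = (-1)^{|x||g|} f(x) ⊗ g(y)` is implemented by
composing with the grading `g` of `X` in the operators `1 ⊗ δ` and `dtᵢ ∧ -`.

The `n`-fold suspension `X[n]` has grading `(-1)^n g` and differential `(-1)^n d`.
-/

namespace Stmt0

open Finset

variable {R : Type*} [CommRing R] {X : Type*} [AddCommGroup X] [Module R X] {n : ℕ}

/-- The model for `X ⊗_R K(t)`: the component at `I : Finset (Fin n)` is `X · dt_I`. -/
abbrev KT (X : Type*) (n : ℕ) := Finset (Fin n) → X

/-- The sign `(-1)^{#{j ∈ I | j < i}}` arising when moving `dtᵢ` into `dt_I`. -/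
def ksign (R : Type*) [CommRing R] {n : ℕ} (i : Fin n) (I : Finset (Fin n)) : R :=
  (-1 : R) ^ (I.filter (fun j => j < i)).card

/-- The grading involution of `X ⊗ K(t)`. -/
def gradKT (g : Module.End R X) : Module.End R (KT X n) :=
  LinearMap.pi fun I => ((-1 : R) ^ I.card • g) ∘ₗ LinearMap.proj I

/-- `d ⊗ 1`. -/
def dKT (d : Module.End R X) : Module.End R (KT X n) :=
  LinearMap.pi fun I => d ∘ₗ LinearMap.proj I

/-- `1 ⊗ δ` (`δ` = contraction with `Σᵢ tᵢ (dtᵢ)*`), with Koszul sign implemented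
by the grading `g` of `X`. -/
def delKT (g : Module.End R X) (t : Fin n → R) : Module.End R (KT X n) :=
  LinearMap.pi fun J =>
    ∑ i : Fin n,
      if i ∈ J then 0
      else (ksign R i J * t i) • (g ∘ₗ LinearMap.proj (insert i J))

/-- Left exterior multiplication `dtᵢ ∧ -` on `X ⊗ K(t)`, with Koszul sign:
`x ⊗ ω ↦ (-1)^{|x|} x ⊗ (dtᵢ ∧ ω)`. -/
def wedgeKT (g : Module.End R X) (i : Fin n) : Module.End R (KT X n) :=
  LinearMap.pi fun J =>
    if i ∈ J then ksign R i J • (g ∘ₗ LinearMap.proj (J.erase i)) else 0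

/-- `λ ⊗ 1`. -/
def lamKT (l : Module.End R X) : Module.End R (KT X n) :=
  LinearMap.pi fun I => l ∘ₗ LinearMap.proj I

/-- The inclusion of `X = X · dt_∅` into `X ⊗ K(t)`. -/
def inclKT (R : Type*) [CommRing R] (X : Type*) [AddCommGroup X] [Module R X] (n : ℕ) :
    X →ₗ[R] KT X n :=
  LinearMap.single R (fun _ : Finset (Fin n) => X) ∅

/-- The signed projection `ε : X ⊗ K(t) → X[n]`, `ε(x · dt₁⋯dtₙ) = (-1)^{n|x|} x`
(the sign `(-1)^{n|x|}` is implemented as `gⁿ`). -/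
def epsKT (g : Module.End R X) (n : ℕ) : KT X n →ₗ[R] X :=
  (g ^ n) ∘ₗ LinearMap.proj (univ : Finset (Fin n))

theorem mul_list_prod_of_anticomm {A : Type*} [Ring A] [Algebra R A] (a : A) (l : List A)
    (h : ∀ b ∈ l, a * b = -(b * a)) :
    a * l.prod = l.prod * ((-1 : R) ^ l.length • a) := by
  induction l with
  | nil => simp
  | cons b l ih =>
    have hb := h b (by simp)
    have hl := ih fun c hc => h c (by simp [hc])
    rw [List.prod_cons, ← mul_assoc, hb, neg_mul, mul_assoc, hl, List.length_cons, pow_succ]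
    simp [mul_assoc]

theorem ksign_mul_self (i : Fin n) (I : Finset (Fin n)) : ksign R i I * ksign R i I = 1 := by
  simp [ksign, ← mul_pow]

theorem ksign_insert {i k : Fin n} {I : Finset (Fin n)} (hk : k ∉ I) :
    ksign R i (insert k I) = (if k < i then -1 else 1) * ksign R i I := by
  unfold ksign
  rw [filter_insert]
  split_ifs with h
  · rw [card_insert_of_notMem (by simp [hk]), pow_succ, mul_comm]
  · simp

theorem ksign_insert_self {i : Fin n} {I : Finset (Fin n)} (hi : i ∉ I) :
    ksign R i (insert i I) = ksign R i I := by
  simp [ksign_insert hi]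

theorem ksign_swap {i k : Fin n} {I : Finset (Fin n)} (hik : i ≠ k) (hi : i ∉ I) (hk : k ∉ I) :
    ksign R k (insert i I) * ksign R i (insert k (insert i I)) =
      -(ksign R i (insert i I) * ksign R k I) := by
  rw [ksign_insert (i := i) (k := k) (by simp [hk, hik.symm]), ksign_insert_self hi,
    ksign_insert hi]
  rcases lt_or_gt_of_ne hik with h | h
  · simp [h, h.not_gt, mul_comm]
  · simp [h, h.not_gt, mul_comm]

theorem delKT_apply (g : Module.End R X) (t : Fin n → R) (f : KT X n) (J : Finset (Fin n)) :
    delKT g t f J =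
      ∑ i : Fin n, if i ∈ J then 0 else (ksign R i J * t i) • g (f (insert i J)) := by
  simp only [delKT, LinearMap.pi_apply, LinearMap.sum_apply]
  refine sum_congr rfl fun i _ => ?_
  split_ifs <;> simp

theorem wedgeKT_apply (g : Module.End R X) (i : Fin n) (f : KT X n) (J : Finset (Fin n)) :
    wedgeKT g i f J = if i ∈ J then ksign R i J • g (f (J.erase i)) else 0 := by
  simp only [wedgeKT, LinearMap.pi_apply]
  split_ifs <;> simp

theorem gradKT_apply (g : Module.End R X) (f : KT X n) (J : Finset (Fin n)) :
    gradKT g f J = (-1 : R) ^ J.card • g (f J) := rfl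

theorem lamKT_apply (l : Module.End R X) (f : KT X n) (J : Finset (Fin n)) :
    lamKT l f J = l (f J) := rfl

theorem dKT_apply (d : Module.End R X) (f : KT X n) (J : Finset (Fin n)) :
    dKT d f J = d (f J) := rfl

theorem gradKT_wedgeKT (g : Module.End R X) (i : Fin n) :
    gradKT g * wedgeKT g i = -(wedgeKT g i * gradKT g) := by
  refine LinearMap.ext fun f => funext fun J => ?_
  simp only [Module.End.mul_apply, LinearMap.neg_apply, Pi.neg_apply, gradKT_apply, wedgeKT_apply]
  split_ifs with h
  · rw [← card_erase_add_one h, pow_succ]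
    simp [smul_smul, mul_comm]
  · simp

theorem gradKT_lamKT {g l : Module.End R X} (h : l * g = -(g * l)) :
    gradKT (n := n) g * lamKT l = -(lamKT l * gradKT g) := by
  refine LinearMap.ext fun f => funext fun J => ?_
  have := LinearMap.congr_fun h (f J)
  simp only [Module.End.mul_apply, LinearMap.neg_apply] at this
  simp [gradKT_apply, lamKT_apply, this]

theorem dKT_wedgeKT {g d : Module.End R X} (h : d * g = -(g * d)) (i : Fin n) :
    dKT d * wedgeKT g i = -(wedgeKT g i * dKT d) := by
  refine LinearMap.ext fun f => funext fun J => ?_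
  have := LinearMap.congr_fun h (f (J.erase i))
  simp only [Module.End.mul_apply, LinearMap.neg_apply] at this
  simp only [Module.End.mul_apply, LinearMap.neg_apply, Pi.neg_apply, dKT_apply, wedgeKT_apply]
  split_ifs <;> simp [this]

theorem delKT_lamKT {g l : Module.End R X} (h : l * g = -(g * l)) (t : Fin n → R) :
    delKT g t * lamKT l = -(lamKT l * delKT g t) := by
  refine LinearMap.ext fun f => funext fun J => ?_
  have key : ∀ x, g (l x) = -l (g x) := fun x => by
    have := LinearMap.congr_fun h x
    simp only [Module.End.mul_apply, LinearMap.neg_apply] at this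
    rw [this, neg_neg]
  simp only [Module.End.mul_apply, LinearMap.neg_apply, Pi.neg_apply, delKT_apply, lamKT_apply,
    map_sum, ← sum_neg_distrib]
  refine sum_congr rfl fun i _ => ?_
  split_ifs <;> simp [key]

theorem dKT_lamKT {d l : Module.End R X} {c : R} (h : l * d + d * l = c • 1) :
    dKT (n := n) d * lamKT l = c • 1 - lamKT l * dKT d := by
  refine LinearMap.ext fun f => funext fun J => ?_
  have := LinearMap.congr_fun h (f J)
  simp only [LinearMap.add_apply, Module.End.mul_apply, LinearMap.smul_apply,
    Module.End.one_apply] at this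
  simp [dKT_apply, lamKT_apply, ← this]

theorem delKT_wedgeKT {g : Module.End R X} (hg : g * g = 1) (t : Fin n → R) (i : Fin n) :
    delKT g t * wedgeKT g i = t i • 1 - wedgeKT g i * delKT g t := by
  refine LinearMap.ext fun f => funext fun J => ?_
  have hgg : ∀ x, g (g x) = x := fun x => LinearMap.congr_fun hg x
  simp only [Module.End.mul_apply, LinearMap.sub_apply, Pi.sub_apply, LinearMap.smul_apply,
    Pi.smul_apply, Module.End.one_apply]
  rw [delKT_apply, wedgeKT_apply]
  simp only [wedgeKT_apply]
  by_cases hi : i ∈ J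
  · obtain ⟨I, hiI, rfl⟩ : ∃ I, i ∉ I ∧ insert i I = J :=
      ⟨J.erase i, notMem_erase i J, insert_erase hi⟩
    rw [if_pos hi, erase_insert hiI, delKT_apply, eq_sub_iff_add_eq, map_sum, smul_sum,
      ← sum_add_distrib, sum_eq_single i]
    · simp [hiI, hgg, smul_smul, ksign_insert_self, ← mul_assoc, ksign_mul_self]
    · intro k _ hk
      by_cases hkI : k ∈ I
      · simp [hkI]
      · have he : (insert k (insert i I)).erase i = insert k I := by
          rw [Finset.insert_comm, erase_insert (by simp [hiI, hk.symm])]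
        have hs := ksign_swap (R := R) hk.symm hiI hkI
        simp only [mem_insert, hk, hkI, or_self, if_false, true_or, or_true, if_true, he,
          map_smul, hgg, smul_smul, ← add_smul]
        convert zero_smul R _
        linear_combination t k * hs
    · simp
  · rw [if_neg hi, sub_zero, sum_eq_single i]
    · simp [hi, hgg, smul_smul, ksign_insert_self, mul_right_comm _ (t i), ksign_mul_self]
    · intro k _ hk
      simp [hi, hk.symm]
    · simp

theorem delKT_inclKT (g : Module.End R X) (t : Fin n → R) (x : X) :
    delKT g t (inclKT R X n x) = 0 := by
  funext J
  rw [delKT_apply]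
  refine sum_eq_zero fun i _ => ?_
  split_ifs <;> simp [inclKT]

theorem dKT_inclKT (d : Module.End R X) (x : X) :
    dKT d (inclKT R X n x) = inclKT R X n (d x) := by
  funext J
  by_cases h : J = ∅
  · subst h; simp [dKT_apply, inclKT]
  · simp [dKT_apply, inclKT, h]

theorem gradKT_inclKT (g : Module.End R X) (x : X) :
    gradKT g (inclKT R X n x) = inclKT R X n (g x) := by
  funext J
  by_cases h : J = ∅
  · subst h; simp [gradKT_apply, inclKT]
  · simp [gradKT_apply, inclKT, h]

/-- For a strictly increasing list `l`, the product of the operators `dtᵢ - λᵢ` over `l` sends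
`x` to an element supported on subsets of `l` whose component at `l` itself is `g ^ |l| x`. -/
theorem prod_wedgeKT_sub_lamKT (g : Module.End R X) (lam : Fin n → Module.End R X) (x : X)
    (l : List (Fin n)) (hl : l.Pairwise (· < ·)) :
    (∀ J, ¬ J ⊆ l.toFinset →
      ((l.map fun i => wedgeKT g i - lamKT (lam i)).prod : Module.End R (KT X n))
        (inclKT R X n x) J = 0) ∧
    ((l.map fun i => wedgeKT g i - lamKT (lam i)).prod : Module.End R (KT X n))
        (inclKT R X n x) l.toFinset =
      (g ^ l.length) x := by
  induction l with
  | nil =>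
    refine ⟨fun J hJ => ?_, by simp [inclKT]⟩
    have : J ≠ ∅ := by simpa using hJ
    simp [inclKT, this]
  | cons i l ih =>
    obtain ⟨hi, hl⟩ := List.pairwise_cons.1 hl
    obtain ⟨h0, h1⟩ := ih hl
    have hil : i ∉ l.toFinset := fun h => (hi i (List.mem_toFinset.1 h)).false
    simp only [List.map_cons, List.prod_cons, Module.End.mul_apply, LinearMap.sub_apply,
      Pi.sub_apply, wedgeKT_apply, lamKT_apply, List.toFinset_cons]
    refine ⟨fun J hJ => ?_, ?_⟩
    · rw [h0 J fun h => hJ (h.trans (subset_insert _ _)),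
        h0 (J.erase i) fun h => hJ (subset_insert_iff.2 h)]
      simp
    · have hs : ksign R i (insert i l.toFinset) = 1 := by
        rw [ksign_insert_self hil, ksign, filter_eq_empty_iff.2, card_empty, pow_zero]
        exact fun j hj => (hi j (List.mem_toFinset.1 hj)).not_gt
      rw [h0 _ fun h => hil (h (mem_insert_self _ _)), erase_insert hil, h1, hs]
      simp [pow_succ']

end Stmt0

open Stmt0 in
theorem statement0
    {R : Type*} [CommRing R] (W : R) (n : ℕ) (t : Fin n → R)
    {X : Type*} [AddCommGroup X] [Module R X]
    -- (X, d) a linear factorisation of W over R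
    (g d : Module.End R X)
    (hg : g * g = 1)
    (hd_odd : d * g = -(g * d))
    (hd_sq : d * d = W • (1 : Module.End R X))
    -- odd homotopies λᵢ with λᵢ d + d λᵢ = tᵢ · 1
    (lam : Fin n → Module.End R X)
    (hlam_odd : ∀ i, lam i * g = -(g * lam i))
    (hlam : ∀ i, lam i * d + d * lam i = t i • (1 : Module.End R X)) :
    -- θ' = (dt₁ - λ₁) ∘ ⋯ ∘ (dtₙ - λₙ)  (applied to X = X · dt_∅ ⊆ X ⊗ K(t))
    let θ' : X →ₗ[R] KT X n :=
      (((List.ofFn fun i => wedgeKT g i - lamKT (lam i)).prod :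
          Module.End R (KT X n))) ∘ₗ inclKT R X n
    -- θ' is a morphism of linear factorisations X[n] → X ⊗ K(t):
    -- it is even (as a map out of X[n]) and commutes with the differentials,
    (gradKT g ∘ₗ θ' = θ' ∘ₗ (((-1 : R) ^ n) • g)) ∧
    ((dKT d + delKT g t) ∘ₗ θ' = θ' ∘ₗ (((-1 : R) ^ n) • d)) ∧
    -- and ε ∘ θ' = 1.
    (epsKT g n ∘ₗ θ' = LinearMap.id) := by
  intro θ'
  have hgg : ∀ k : ℕ, g ^ k * g ^ k = 1 := fun k => by
    rw [← (Commute.refl g).mul_pow, hg, one_pow]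
  refine ⟨?_, ?_, ?_⟩
  · have h := mul_list_prod_of_anticomm (R := R) (gradKT g)
      (List.ofFn fun i => wedgeKT g i - lamKT (lam i)) (by
        intro b hb
        obtain ⟨i, rfl⟩ := (List.mem_ofFn' _ _).1 hb
        rw [mul_sub, sub_mul, gradKT_wedgeKT, gradKT_lamKT (hlam_odd i)]
        abel)
    rw [List.length_ofFn] at h
    refine LinearMap.ext fun x => ?_
    have hx := LinearMap.congr_fun h (inclKT R X n x)
    simpa [θ', gradKT_inclKT] using hx
  · have h := mul_list_prod_of_anticomm (R := R) (dKT d + delKT g t)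
      (List.ofFn fun i => wedgeKT g i - lamKT (lam i)) (by
        intro b hb
        obtain ⟨i, rfl⟩ := (List.mem_ofFn' _ _).1 hb
        rw [mul_sub, sub_mul, add_mul, add_mul, mul_add, mul_add, dKT_wedgeKT hd_odd,
          delKT_wedgeKT hg, dKT_lamKT (hlam i), delKT_lamKT (hlam_odd i)]
        abel)
    rw [List.length_ofFn] at h
    refine LinearMap.ext fun x => ?_
    have hx := LinearMap.congr_fun h (inclKT R X n x)
    simpa [θ', dKT_inclKT, delKT_inclKT] using hx
  · refine LinearMap.ext fun x => ?_
    have h := (prod_wedgeKT_sub_lamKT g lam x (List.finRange n)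
      (List.pairwise_lt_finRange n)).2
    rw [List.toFinset_finRange, List.length_finRange, ← List.ofFn_eq_map] at h
    simp only [θ', epsKT, LinearMap.comp_apply, LinearMap.proj_apply, LinearMap.id_apply, h]
    exact LinearMap.congr_fun (hgg n) x
end

section
/- Let R be a commutative ring, W, W' ∈ R, and let ((L,b),(M,b), i, p, h) be a deformation retract datum of linear factorisations of W over R. Let μ be a degree-one R-linear map on M with (μh)^N = 0 for all sufficiently large N (a small perturbation) and (b+μ)² = W'·1_M. Set A = Σ_{m≥0}(μh)^m μ, i_∞ = i + hAi, p_∞ = p + pAh, h_∞ = h + hAh, b_∞ = b + pAi. If either (1) pμ = 0 and ph = 0 and W' = W, or (2) hi = 0, ph = 0 and h² = 0 (allowing W' ≠ W), then ((L,b_∞),(M,b+μ), i_∞, p_∞, h_∞) is a deformation retract datum of linear factorisations of W' over R. -/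
section Ring

variable {S : Type*} [Ring S]

theorem geom_perturbation_eq_add_mul {μ h : S} {N : ℕ} (hN : (μ * h) ^ N = 0) :
    ∑ m ∈ Finset.range N, (μ * h) ^ m * μ =
      μ + μ * h * ∑ m ∈ Finset.range N, (μ * h) ^ m * μ := by
  have hs := mul_neg_geom_sum (μ * h) N
  rw [hN, sub_zero, sub_mul, one_mul] at hs
  rw [← Finset.sum_mul]
  conv_lhs => rw [eq_add_of_sub_eq hs, add_mul, one_mul]
  simp only [mul_assoc]

theorem geom_perturbation_eq_add_mul' {μ h : S} {N : ℕ} (hN : (μ * h) ^ N = 0) :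
    ∑ m ∈ Finset.range N, (μ * h) ^ m * μ =
      μ + (∑ m ∈ Finset.range N, (μ * h) ^ m * μ) * h * μ := by
  have hs := geom_sum_mul_neg (μ * h) N
  rw [hN, sub_zero, mul_sub, mul_one] at hs
  rw [← Finset.sum_mul]
  conv_lhs => rw [eq_add_of_sub_eq hs, add_mul, one_mul]
  simp only [mul_assoc]

theorem geom_perturbation_odd {μ h g : S} (hh : h * g = -(g * h)) (hμ : μ * g = -(g * μ))
    (N : ℕ) :
    (∑ m ∈ Finset.range N, (μ * h) ^ m * μ) * g =
      -(g * ∑ m ∈ Finset.range N, (μ * h) ^ m * μ) := by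
  have hc : Commute (μ * h) g := by
    rw [Commute, SemiconjBy, mul_assoc, hh, mul_neg, ← mul_assoc, hμ, neg_mul, neg_neg, mul_assoc]
  rw [← Finset.sum_mul, mul_assoc, hμ, mul_neg, ← mul_assoc, ← mul_assoc,
    (Commute.sum_left _ _ _ fun m _ => hc.pow_left m).eq]

theorem perturbation_identity {b h μ A P : S} (hP : P = 1 + (b * h + h * b))
    (hA : A = μ + μ * h * A) (hA' : A = μ + A * h * μ) :
    A * P * A + A * b + b * A =
      (1 + A * h) * ((b + μ) * (b + μ) - b * b) * (1 + h * A) := by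
  have hU : (1 + A * h) * μ = A := by rw [add_mul, one_mul]; exact hA'.symm
  have hV : μ * (1 + h * A) = A := by rw [mul_add, mul_one, ← mul_assoc]; exact hA.symm
  calc A * P * A + A * b + b * A
      = A * b * (1 + h * A) + (1 + A * h) * b * A + A * A := by
        rw [hP]; noncomm_ring
    _ = (1 + A * h) * μ * b * (1 + h * A) + (1 + A * h) * b * (μ * (1 + h * A))
          + (1 + A * h) * μ * (μ * (1 + h * A)) := by rw [hU, hV]
    _ = _ := by noncomm_ring

end Ring

theorem statement1
    {R : Type*} [CommRing R] (W W' : R)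
    {L M : Type*} [AddCommGroup L] [Module R L] [AddCommGroup M] [Module R M]
    -- gradings
    (gL : Module.End R L) (gM : Module.End R M)
    (hgL : gL * gL = 1) (hgM : gM * gM = 1)
    -- differentials (odd, squaring to W)
    (bL : Module.End R L) (bM : Module.End R M)
    (hbL_odd : bL * gL = -(gL * bL)) (hbM_odd : bM * gM = -(gM * bM))
    (hbL_sq : bL * bL = W • (1 : Module.End R L))
    (hbM_sq : bM * bM = W • (1 : Module.End R M))
    -- i and p are morphisms of linear factorisations (even chain maps)
    (i : L →ₗ[R] M) (p : M →ₗ[R] L)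
    (hi_even : gM ∘ₗ i = i ∘ₗ gL) (hp_even : gL ∘ₗ p = p ∘ₗ gM)
    (hi_chain : bM ∘ₗ i = i ∘ₗ bL) (hp_chain : bL ∘ₗ p = p ∘ₗ bM)
    -- the homotopy h, a degree one map
    (h : Module.End R M) (hh_odd : h * gM = -(gM * h))
    -- deformation retract identities:  p i = 1,  i p = 1 + b h + h b
    (hpi : p ∘ₗ i = LinearMap.id)
    (hip : i ∘ₗ p = LinearMap.id + (bM * h + h * bM))
    -- μ is a small perturbation with (b + μ)² = W'·1
    (μ : Module.End R M) (hμ_odd : μ * gM = -(gM * μ))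
    (N : ℕ) (hsmall : (μ * h) ^ N = 0)
    (hpert_sq : (bM + μ) * (bM + μ) = W' • (1 : Module.End R M))
    -- condition (1) or condition (2)
    (hcond : (p ∘ₗ μ = 0 ∧ p ∘ₗ h = 0 ∧ W' = W) ∨
             (h ∘ₗ i = 0 ∧ p ∘ₗ h = 0 ∧ h * h = 0)) :
    -- A = Σ_{m ≥ 0} (μh)^m μ
    let A : Module.End R M := ∑ m ∈ Finset.range N, (μ * h) ^ m * μ
    let iInf : L →ₗ[R] M := i + h ∘ₗ (A ∘ₗ i)
    let pInf : M →ₗ[R] L := p + p ∘ₗ (A ∘ₗ h)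
    let hInf : Module.End R M := h + h * A * h
    let bInf : Module.End R L := bL + p ∘ₗ (A ∘ₗ i)
    -- (L, bInf) is a linear factorisation of W'
    (bInf * gL = -(gL * bInf)) ∧ (bInf * bInf = W' • (1 : Module.End R L)) ∧
    -- (M, b + μ) is a linear factorisation of W'
    ((bM + μ) * gM = -(gM * (bM + μ))) ∧
    -- iInf and pInf are morphisms of linear factorisations
    (gM ∘ₗ iInf = iInf ∘ₗ gL) ∧ ((bM + μ) ∘ₗ iInf = iInf ∘ₗ bInf) ∧
    (gL ∘ₗ pInf = pInf ∘ₗ gM) ∧ (bInf ∘ₗ pInf = pInf ∘ₗ (bM + μ)) ∧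
    -- hInf has degree one
    (hInf * gM = -(gM * hInf)) ∧
    -- deformation retract identities
    (pInf ∘ₗ iInf = LinearMap.id) ∧
    (iInf ∘ₗ pInf = LinearMap.id + ((bM + μ) * hInf + hInf * (bM + μ))) := by
  intro A iInf pInf hInf bInf
  have hA : A = μ + μ * h * A := geom_perturbation_eq_add_mul hsmall
  have hA' : A = μ + A * h * μ := geom_perturbation_eq_add_mul' hsmall
  have hAodd : A * gM = -(gM * A) := geom_perturbation_odd hh_odd hμ_odd N
  have key := perturbation_identity (P := i ∘ₗ p) hip hA hA'
  rw [hpert_sq, hbM_sq, ← sub_smul] at key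
  clear_value A
  replace key (x : M) : A (i (p (A x))) + A (bM x) + bM (A x) =
      (W' - W) • (x + h (A x) + A (h (x + h (A x)))) := by
    simpa using congr($key x)
  replace hA (x : M) : A x = μ x + μ (h (A x)) := congr($hA x)
  replace hA' (x : M) : A x = μ x + A (h (μ x)) := congr($hA' x)
  replace hAodd (x : M) : A (gM x) = -gM (A x) := congr($hAodd x)
  replace hip (x : M) : i (p x) = x + (bM (h x) + h (bM x)) := congr($hip x)
  replace hpi (x : L) : p (i x) = x := congr($hpi x)
  replace hi_chain (x : L) : bM (i x) = i (bL x) := congr($hi_chain x)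
  replace hp_chain (x : M) : bL (p x) = p (bM x) := congr($hp_chain x)
  replace hi_even (x : L) : gM (i x) = i (gL x) := congr($hi_even x)
  replace hp_even (x : M) : gL (p x) = p (gM x) := congr($hp_even x)
  replace hh_odd (x : M) : h (gM x) = -gM (h x) := congr($hh_odd x)
  replace hbL_odd (x : L) : bL (gL x) = -gL (bL x) := congr($hbL_odd x)
  -- The terms carrying the factor `W' - W` vanish under either side condition.
  obtain ⟨hPI, hhh, hhi, hph⟩ : (∀ x, pInf (iInf x) = x) ∧
      (∀ x, (W' - W) • h (h x + h (A (h x)) + A (h (h x + h (A (h x))))) = 0) ∧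
      (∀ x, (W' - W) • h (i x + h (A (i x)) + A (h (i x + h (A (i x))))) = 0) ∧
      (∀ x, (W' - W) • p (h x + h (A (h x)) + A (h (h x + h (A (h x))))) = 0) := by
    rcases hcond with ⟨hpμ, hph, rfl⟩ | ⟨hhi, hph, hhh⟩
    · replace hpμ (x : M) : p (μ x) = 0 := congr($hpμ x)
      replace hph (x : M) : p (h x) = 0 := congr($hph x)
      have hpA (x : M) : p (A x) = 0 := by rw [hA, map_add, hpμ, hpμ, add_zero]
      simp [iInf, pInf, hpA, hph, hpi]
    · replace hhi (x : L) : h (i x) = 0 := congr($hhi x)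
      replace hph (x : M) : p (h x) = 0 := congr($hph x)
      replace hhh (x : M) : h (h x) = 0 := congr($hhh x)
      simp [iInf, pInf, hhi, hph, hhh, hpi]
  have hI (x : L) : (bM + μ) (iInf x) = iInf (bInf x) := by
    have e₁ := congr(h $(key (i x)))
    have e₂ := hip (A (i x))
    have e₃ := hA (i x)
    have e₄ := hhi x
    simp only [iInf, bInf, LinearMap.add_apply, LinearMap.comp_apply, map_add, map_smul,
      smul_add, ← hi_chain] at *
    linear_combination (norm := module) -e₁ - e₂ - e₃ - e₄
  have hP (x : M) : bInf (pInf x) = pInf ((bM + μ) x) := by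
    have e₁ := congr(p $(key (h x)))
    have e₂ := congr(p (A $(hip x)))
    have e₃ := congr(p $(hA' x))
    have e₄ := hph x
    simp only [pInf, bInf, LinearMap.add_apply, LinearMap.comp_apply, map_add, map_smul,
      smul_add, hp_chain] at *
    linear_combination (norm := module) e₁ + e₂ + e₃ + e₄
  refine ⟨?_, ?_, ?_, ?_, LinearMap.ext hI, ?_, LinearMap.ext hP, ?_, LinearMap.ext hPI, ?_⟩
  · ext x
    simp [bInf, hbL_odd, ← hi_even, hAodd, hp_even, add_comm]
  · ext x
    have hsq : (bM + μ) ((bM + μ) (iInf x)) = W' • iInf x := congr($hpert_sq (iInf x))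
    rw [hI, hI] at hsq
    simpa [hPI] using congr(pInf $hsq)
  · rw [add_mul, mul_add, hbM_odd, hμ_odd, neg_add]
  · ext x
    simp [iInf, ← hi_even, hAodd, hh_odd]
  · ext x
    simp [pInf, hp_even, hAodd, hh_odd]
  · ext x
    simp [hInf, hAodd, hh_odd, add_comm]
  · ext x
    have e₁ := congr(h $(key (h x)))
    have e₂ := hip (A (h x))
    have e₃ := congr(h (A $(hip x)))
    have e₄ := hip x
    have e₅ := hA (h x)
    have e₆ := congr(h $(hA' x))
    have e₇ := hhh x
    simp only [iInf, pInf, hInf, LinearMap.add_apply, LinearMap.comp_apply, Module.End.mul_apply,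
      LinearMap.id_apply, map_add, map_smul, smul_add] at *
    linear_combination (norm := module) e₁ + e₂ + e₃ + e₄ + e₅ + e₆ + e₇
end
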